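/- Let F be a real-analytic function on a neighborhood of 0 in ℝ³ (variables (x,y,p)). The following are equivalent. (1) There exist real-analytic functions X, Y on a neighborhood of 0 in ℝ² whose Jacobian matrix at the origin is the identity, such that for all (x,y,p) in a neighborhood of 0, setting q := F(x,y,p): 0 = q·(X_x·Y_y − Y_x·X_y) + (X_x·Y_xx − Y_x·X_xx) + p·( 2(X_x·Y_xy − Y_x·X_xy) − (X_xx·Y_y − Y_xx·X_y) ) + p²·( (X_x·Y_yy − Y_x·X_yy) − 2(X_xy·Y_y − Y_xy·X_y) ) − p³·(X_yy·Y_y − Y_yy·X_y), where all partial derivatives of X and Y are evaluated at (x,y) (this is the prolonged, jet-space form of the statement that the point transformation (x,y) ↦ (X,Y) maps the equation y_xx = F(x,y,y_x) to the free-particle equation Y_XX = 0). (4) F(x,y,p) = G(x,y) + p·H(x,y) + p²·L(x,y) + p³·M(x,y) for some real-analytic functions G, H, L, M defined near 0 in ℝ² that satisfy the two second-order partial differential equations: 0 = −2G_yy + (4/3)H_xy − (2/3)L_xx + 2(G·L)_y − 2G_x·M − 4G·M_x + (2/3)H·L_x − (4/3)H·H_y, and 0 = −(2/3)H_yy + (4/3)L_xy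 − 2M_xx + 2G·M_y + 4G_y·M − 2(H·M)_x − (2/3)H_y·L + (4/3)L·L_x. -/

import Mathlib

/-- Partial derivative in the `x`-direction of a function on `ℝ²`. -/
noncomputable def pdx (f : ℝ × ℝ → ℝ) : ℝ × ℝ → ℝ := fun p => fderiv ℝ f p (1, 0)

/-- Partial derivative in the `y`-direction of a function on `ℝ²`. -/
noncomputable def pdy (f : ℝ × ℝ → ℝ) : ℝ × ℝ → ℝ := fun p => fderiv ℝ f p (0, 1)

open Topology unitInterval

section Radial

variable {V E : Type*} [NormedAddCommGroup V] [NormedSpace ℝ V]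
  [NormedAddCommGroup E] [NormedSpace ℝ E]

/-- The monomial path `t ↦ t ^ n • v` on the unit interval, as a bounded linear function of `v`. -/
noncomputable def monomialPath (E : Type*) [NormedAddCommGroup E] [NormedSpace ℝ E] (n : ℕ) :
    E →L[ℝ] C(I, E) :=
  LinearMap.mkContinuous
    { toFun := fun v => ⟨fun t => (t : ℝ) ^ n • v, by fun_prop⟩
      map_add' := fun u v => by ext t; simp
      map_smul' := fun c v => by ext t; simp [smul_comm c] }
    1 fun v => by
      rw [one_mul]
      refine (ContinuousMap.norm_le _ (norm_nonneg v)).2 fun t => ?_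
      have h : |(t : ℝ)| ≤ 1 := abs_le.2 ⟨by linarith [t.2.1], t.2.2⟩
      simpa [norm_smul] using
        mul_le_of_le_one_left (norm_nonneg v) (pow_le_one₀ (abs_nonneg _) h)

@[simp]
theorem monomialPath_apply (n : ℕ) (v : E) (t : I) : monomialPath E n v t = (t : ℝ) ^ n • v := rfl

theorem norm_monomialPath_le (n : ℕ) : ‖monomialPath E n‖ ≤ 1 :=
  LinearMap.mkContinuous_norm_le _ zero_le_one _

/-- The restrictions of an analytic function to the segments issuing from the origin depend
analytically, in the uniform norm, on the endpoint of the segment. -/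
theorem AnalyticAt.exists_radial [CompleteSpace E] {f : V → E} (hf : AnalyticAt ℝ f 0) :
    ∃ g : V → C(I, E), AnalyticAt ℝ g 0 ∧ ∀ᶠ z in 𝓝 0, ∀ t : I, g z t = f ((t : ℝ) • z) := by
  obtain ⟨p, r, hp⟩ := hf
  let q : FormalMultilinearSeries ℝ V C(I, E) :=
    fun n => (monomialPath E n).compContinuousMultilinearMap (p n)
  have hqp : ∀ n, ‖q n‖ ≤ ‖p n‖ := fun n =>
    ((monomialPath E n).norm_compContinuousMultilinearMap_le (p n)).trans
      (mul_le_of_le_one_left (norm_nonneg _) (norm_monomialPath_le n))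
  have hrad : p.radius ≤ q.radius := FormalMultilinearSeries.radius_le_of_le fun n => hqp n
  have hq := q.hasFPowerSeriesOnBall (hp.radius_pos.trans_le hrad)
  refine ⟨q.sum, hq.analyticAt, ?_⟩
  filter_upwards [Metric.eball_mem_nhds (0 : V) hp.r_pos] with z hz t
  have hzq : z ∈ Metric.eball (0 : V) q.radius :=
    Metric.eball_subset_eball (hp.r_le.trans hrad) hz
  have htz : (t : ℝ) • z ∈ Metric.eball (0 : V) r := by
    rw [Metric.mem_eball, edist_zero_right] at hz ⊢
    refine lt_of_le_of_lt ?_ hz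
    rw [enorm_smul]
    refine mul_le_of_le_one_left' ?_
    rw [Real.enorm_eq_ofReal t.2.1]
    exact ENNReal.ofReal_le_one.2 t.2.2
  have h1 := (ContinuousMap.evalCLM ℝ t).hasSum (hq.hasSum hzq)
  have h2 := hp.hasSum htz
  rw [zero_add] at h1 h2
  refine h1.unique ?_
  convert! h2 using 2 with n
  simp [q, ContinuousMultilinearMap.map_smul_univ]

/-- The primitive vanishing at `0`, as a bounded operator on continuous paths. -/
noncomputable def pathPrimitive (E : Type*) [NormedAddCommGroup E] [NormedSpace ℝ E]
    [CompleteSpace E] : C(I, E) →L[ℝ] C(I, E) :=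
  LinearMap.mkContinuous
    { toFun := fun f => ⟨fun t => ∫ s in (0 : ℝ)..t, Set.IccExtend zero_le_one f s,
        (intervalIntegral.continuous_primitive
          (fun _ _ => (f.continuous.Icc_extend').intervalIntegrable _ _) 0).comp
            continuous_subtype_val⟩
      map_add' := fun f g => by
        ext t
        exact intervalIntegral.integral_add ((f.continuous.Icc_extend').intervalIntegrable _ _)
          ((g.continuous.Icc_extend').intervalIntegrable _ _)
      map_smul' := fun c f => by
        ext t
        exact intervalIntegral.integral_smul c _ }
    1 fun f => by
      rw [one_mul]
      refine (ContinuousMap.norm_le _ (norm_nonneg f)).2 fun t => ?_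
      refine (intervalIntegral.norm_integral_le_of_norm_le_const (C := ‖f‖)
        fun s _ => f.norm_coe_le_norm _).trans ?_
      rw [sub_zero, abs_of_nonneg t.2.1]
      exact mul_le_of_le_one_right (norm_nonneg f) t.2.2

theorem pathPrimitive_apply [CompleteSpace E] (f : C(I, E)) (t : I) :
    pathPrimitive E f t = ∫ s in (0 : ℝ)..t, Set.IccExtend zero_le_one f s := rfl

end Radial

section Frobenius

variable {V R : Type*} [NormedAddCommGroup V] [NormedSpace ℝ V]
  [NormedRing R] [NormedAlgebra ℝ R] [CompleteSpace R]

/-- Analyticity of a bilinear expression in two analytic functions. -/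
theorem AnalyticAt.bilinear_apply {E F G : Type*} [NormedAddCommGroup E] [NormedSpace ℝ E]
    [NormedAddCommGroup F] [NormedSpace ℝ F] [NormedAddCommGroup G] [NormedSpace ℝ G]
    (f : E →L[ℝ] F →L[ℝ] G) {a : V → E} {b : V → F} {z : V}
    (ha : AnalyticAt ℝ a z) (hb : AnalyticAt ℝ b z) :
    AnalyticAt ℝ (fun z => f (a z) (b z)) z :=
  (f.analyticAt_bilinear (a z, b z)).comp₂ ha hb

/-- In a Banach algebra `B`, the fixed point equation `w = 1 + J (Ω * w)` whose coefficient `Ω`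
depends analytically on a parameter and vanishes at the origin has, near the origin, a unique
solution, which depends analytically on the parameter. -/
theorem AnalyticAt.exists_fixedPoint {B : Type*} [NormedRing B] [NormedAlgebra ℝ B]
    [CompleteSpace B] (J : B →L[ℝ] B) {Ω : V → B} (hΩ : AnalyticAt ℝ Ω 0) (hΩ0 : Ω 0 = 0) :
    ∃ w : V → B, AnalyticAt ℝ w 0 ∧ ∀ᶠ z in 𝓝 0,
      w z = 1 + J (Ω z * w z) ∧ ∀ q, q = J (Ω z * q) → q = 0 := by
  let K : V → B →L[ℝ] B := fun z => J.comp (ContinuousLinearMap.mul ℝ B (Ω z))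
  have hK : AnalyticAt ℝ K 0 :=
    (((ContinuousLinearMap.compL ℝ B B B J).comp (ContinuousLinearMap.mul ℝ B)).analyticAt _).comp
      hΩ
  have hK0 : K 0 = 0 := by simp [K, hΩ0]
  have hinv : AnalyticAt ℝ (fun z => Ring.inverse (1 - K z)) 0 := by
    refine AnalyticAt.fun_comp (g := fun T => Ring.inverse (1 - T)) ?_ hK
    rw [hK0]
    exact analyticAt_inverse_one_sub ℝ (B →L[ℝ] B)
  refine ⟨fun z => Ring.inverse (1 - K z) 1,
    hinv.bilinear_apply (ContinuousLinearMap.id ℝ _) analyticAt_const, ?_⟩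
  have hunit : ∀ᶠ z in 𝓝 (0 : V), IsUnit (1 - K z) := by
    refine (analyticAt_const.sub hK).continuousAt.eventually
      (p := fun T : B →L[ℝ] B => IsUnit T) (Units.isOpen.mem_nhds ?_)
    simp [hK0]
  filter_upwards [hunit] with z hz
  constructor
  · have h : (1 - K z) (Ring.inverse (1 - K z) 1) = 1 :=
      DFunLike.congr_fun (Ring.mul_inverse_cancel _ hz) (1 : B)
    exact sub_eq_iff_eq_add.1 h
  · intro q hq
    have h : Ring.inverse (1 - K z) ((1 - K z) q) = q :=
      DFunLike.congr_fun (Ring.inverse_mul_cancel _ hz) q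
    have h0 : (1 - K z) q = 0 := sub_eq_zero.2 hq
    rw [← h, h0, map_zero]

/-- Evaluation of a path of continuous linear maps at a fixed vector. -/
noncomputable def evalPath (V E : Type*) [NormedAddCommGroup V] [NormedSpace ℝ V]
    [NormedAddCommGroup E] [NormedSpace ℝ E] : C(I, V →L[ℝ] E) →L[ℝ] V →L[ℝ] C(I, E) :=
  LinearMap.mkContinuous₂
    (LinearMap.mk₂ ℝ (fun (f : C(I, V →L[ℝ] E)) v => (⟨fun t => f t v, by fun_prop⟩ : C(I, E)))
      (fun f g v => by ext t; simp) (fun c f v => by ext t; simp)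
      (fun f u v => by ext t; simp) (fun c f v => by ext t; simp))
    1 fun f v => by
      rw [one_mul]
      refine (ContinuousMap.norm_le _ (by positivity)).2 fun t => ?_
      exact (f t).le_of_opNorm_le (f.norm_coe_le_norm t) v

@[simp]
theorem evalPath_apply {E : Type*} [NormedAddCommGroup E] [NormedSpace ℝ E]
    (f : C(I, V →L[ℝ] E)) (v : V) (t : I) : evalPath V E f v t = f t v := rfl

/-- **Frobenius theorem for flat connections**, analytic case: an analytic `1`-form `ω` with values
in a Banach algebra and `dω = ω ∧ ω` is near the origin of the form `dW * W⁻¹`. -/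
theorem AnalyticAt.exists_fderiv_eq_mul {ω : V → V →L[ℝ] R} (hω : AnalyticAt ℝ ω 0)
    (hflat : ∀ᶠ z in 𝓝 0, ∀ u v, fderiv ℝ ω z u v - fderiv ℝ ω z v u
      = ω z u * ω z v - ω z v * ω z u) :
    ∃ W : V → R, AnalyticAt ℝ W 0 ∧ W 0 = 1 ∧
      ∀ᶠ z in 𝓝 0, ∀ v, fderiv ℝ W z v = ω z v * W z := by
  obtain ⟨g, hg, hgω⟩ := hω.exists_radial
  let Ω : V → C(I, R) := fun z => evalPath V R (g z) z
  have hΩ : AnalyticAt ℝ Ω 0 :=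
    hg.bilinear_apply (evalPath V R) analyticAt_id
  obtain ⟨w, hw, hwΩ⟩ := hΩ.exists_fixedPoint (pathPrimitive R) (by simp [Ω])
  let W : V → R := fun z => w z 1
  have hW : AnalyticAt ℝ W 0 :=
    (ContinuousLinearMap.analyticAt (ContinuousMap.evalCLM ℝ (1 : I) : C(I, R) →L[ℝ] R) _).comp hw
  obtain ⟨ρ, hρ, hball⟩ := Metric.eventually_nhds_iff_ball.1 (hgω.and (hwΩ.and
    (hflat.and (hω.eventually_analyticAt.and hW.eventually_analyticAt))))
  have hΩω : ∀ z ∈ Metric.ball (0 : V) ρ, ∀ t : I, Ω z t = ω ((t : ℝ) • z) z := fun z hz t => by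
    simp [Ω, (hball z hz).1 t]
  have hsmul : ∀ z ∈ Metric.ball (0 : V) ρ, ∀ t ∈ I, t • z ∈ Metric.ball (0 : V) ρ := by
    intro z hz t ht
    rw [mem_ball_zero_iff] at hz ⊢
    rw [norm_smul, Real.norm_of_nonneg ht.1]
    exact (mul_le_of_le_one_left (norm_nonneg z) ht.2).trans_lt hz
  -- the solution along a ray restricts `W` to that ray
  have hray : ∀ z ∈ Metric.ball (0 : V) ρ, ∀ s : I, W ((s : ℝ) • z) = w z s := by
    intro z hz s
    have hsz := hsmul z hz s s.2
    let q : C(I, R) := ⟨fun t => w z (s * t), by fun_prop⟩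
    have hq : q = 1 + pathPrimitive R (Ω ((s : ℝ) • z) * q) := by
      ext t
      have h1 : w z (s * t) = 1 + pathPrimitive R (Ω z * w z) (s * t) :=
        DFunLike.congr_fun (hball z hz).2.1.1 (s * t)
      change w z (s * t) = 1 + pathPrimitive R (Ω ((s : ℝ) • z) * q) t
      rw [h1, pathPrimitive_apply, pathPrimitive_apply]
      congr 1
      have h2 := intervalIntegral.smul_integral_comp_mul_left (a := 0) (b := t)
        (Set.IccExtend zero_le_one (Ω z * w z)) (s : ℝ)
      rw [mul_zero] at h2
      rw [Set.Icc.coe_mul, ← h2, ← intervalIntegral.integral_smul]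
      refine intervalIntegral.integral_congr fun τ hτ => ?_
      rw [Set.uIcc_of_le t.2.1] at hτ
      have hτI : τ ∈ I := ⟨hτ.1, hτ.2.trans t.2.2⟩
      have hsτI : (s : ℝ) * τ ∈ I := (s * ⟨τ, hτI⟩ : I).2
      simp only [Set.IccExtend_of_mem zero_le_one _ hτI, Set.IccExtend_of_mem zero_le_one _ hsτI]
      change (s : ℝ) • (Ω z ⟨s * τ, hsτI⟩ * w z ⟨s * τ, hsτI⟩)
        = Ω ((s : ℝ) • z) ⟨τ, hτI⟩ * w z (s * ⟨τ, hτI⟩)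
      rw [hΩω z hz, hΩω _ hsz]
      simp only [map_smul, smul_smul, smul_mul_assoc, mul_comm τ]
      rfl
    have hz' := (hball _ hsz).2.1
    have h0 : q - w ((s : ℝ) • z) = 0 := hz'.2 _ <| by
      conv_lhs => rw [hq, hz'.1]
      rw [mul_sub, map_sub]
      abel
    have h1 := DFunLike.congr_fun (sub_eq_zero.1 h0) 1
    simpa [q, W] using h1.symm
  have hEuler : ∀ z ∈ Metric.ball (0 : V) (ρ / 2), fderiv ℝ W z z = ω z z * W z := by
    intro z hz
    have h2z : (2 : ℝ) • z ∈ Metric.ball (0 : V) ρ := by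
      rw [mem_ball_zero_iff] at hz ⊢
      rw [norm_smul]
      norm_num
      linarith
    have hhalf : (1 / 2 : ℝ) ∈ I := by constructor <;> norm_num
    have hz1 : (1 / 2 : ℝ) • (2 : ℝ) • z = z := by simp [smul_smul]
    have hzρ : z ∈ Metric.ball (0 : V) ρ := Metric.ball_subset_ball (by linarith) hz
    have hd1 : HasDerivAt (fun t : ℝ => W (t • (2 : ℝ) • z)) (fderiv ℝ W z ((2 : ℝ) • z))
        (1 / 2) := by
      have h := (hball z hzρ).2.2.2.2.differentiableAt.hasFDerivAt
      rw [← hz1] at h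
      have h' := h.comp_hasDerivAt (1 / 2 : ℝ)
        ((hasDerivAt_id (1 / 2 : ℝ)).smul_const ((2 : ℝ) • z))
      simp only [hz1, one_smul] at h'
      exact h'
    have hcont : Continuous (Set.IccExtend zero_le_one (Ω ((2 : ℝ) • z) * w ((2 : ℝ) • z))) :=
      (Ω ((2 : ℝ) • z) * w ((2 : ℝ) • z)).continuous.Icc_extend'
    have hd2 := ((hcont.integral_hasStrictDerivAt 0 (1 / 2)).hasDerivAt).const_add (1 : R)
    have hev : (fun t : ℝ => W (t • (2 : ℝ) • z)) =ᶠ[𝓝 (1 / 2)] fun t => 1 + ∫ s in (0 : ℝ)..t,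
        Set.IccExtend zero_le_one (Ω ((2 : ℝ) • z) * w ((2 : ℝ) • z)) s := by
      filter_upwards [Icc_mem_nhds (show (0 : ℝ) < 1 / 2 by norm_num)
        (show (1 / 2 : ℝ) < 1 by norm_num)] with t ht
      exact (hray _ h2z ⟨t, ht⟩).trans (DFunLike.congr_fun (hball _ h2z).2.1.1 ⟨t, ht⟩)
    have h := hd1.unique (hd2.congr_of_eventuallyEq hev)
    rw [Set.IccExtend_of_mem _ _ hhalf, ContinuousMap.mul_apply, hΩω _ h2z, ← hray _ h2z, hz1,
      map_smul, map_smul, smul_mul_assoc] at h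
    exact smul_right_injective R two_ne_zero h
  have hW0 : W 0 = 1 := by
    have h := hray 0 (Metric.mem_ball_self hρ) 0
    rw [smul_zero] at h
    rw [h, (hball 0 (Metric.mem_ball_self hρ)).2.1.1]
    simp [pathPrimitive_apply]
  have hsub : Metric.ball (0 : V) (ρ / 2) ⊆ Metric.ball 0 ρ :=
    Metric.ball_subset_ball (half_le_self hρ.le)
  refine ⟨W, hW, hW0, ?_⟩
  filter_upwards [Metric.ball_mem_nhds (0 : V) (half_pos hρ)] with z hz v
  let P : V → R := fun y => fderiv ℝ W y v - ω y v * W y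
  have hP : ∀ y ∈ Metric.ball (0 : V) (ρ / 2), DifferentiableAt ℝ P y ∧
      fderiv ℝ P y y + P y = ω y y * P y := by
    intro y hy
    have hya := (hball y (hsub hy)).2.2.2.2
    have hWd := hya.differentiableAt.hasFDerivAt
    have hWdd := hya.fderiv.differentiableAt.hasFDerivAt
    have hωd := (hball y (hsub hy)).2.2.2.1.differentiableAt.hasFDerivAt
    have hPd := (hWdd.clm_apply (hasFDerivAt_const v y)).sub
      ((hωd.clm_apply (hasFDerivAt_const v y)).mul' hWd)
    have hEd := (hWdd.clm_apply (hasFDerivAt_id y)).sub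
      ((hωd.clm_apply (hasFDerivAt_id y)).mul' hWd)
    have hE0 : HasFDerivAt (fun y => fderiv ℝ W y y - ω y y * W y) (0 : V →L[ℝ] R) y := by
      refine (hasFDerivAt_const (0 : R) y).congr_of_eventuallyEq ?_
      filter_upwards [Metric.isOpen_ball.mem_nhds hy] with x hx
      exact sub_eq_zero.2 (hEuler x hx)
    have hE := DFunLike.congr_fun (hEd.unique hE0) v
    have hsymm := hya.contDiffAt.isSymmSndFDerivAt_of_omega y v
    have hfl := (hball y (hsub hy)).2.2.1 y v
    refine ⟨hPd.differentiableAt, ?_⟩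
    have hPd' : HasFDerivAt P _ y := hPd
    rw [hPd'.fderiv]
    have hfl' := congrArg (· * W y) hfl
    simp [P] at hE hfl' ⊢
    rw [hEuler y hy, hsymm]
    linear_combination (norm := noncomm_ring) hE - hfl'
  let φ : ℝ → R := fun t => t • P (t • z)
  have hφ : ∀ t ∈ I, HasDerivAt φ (ω (t • z) z * φ t) t := by
    intro t ht
    have htz : t • z ∈ Metric.ball (0 : V) (ρ / 2) := by
      rw [mem_ball_zero_iff] at hz ⊢
      rw [norm_smul, Real.norm_of_nonneg ht.1]
      exact (mul_le_of_le_one_left (norm_nonneg z) ht.2).trans_lt hz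
    obtain ⟨hPd, hPe⟩ := hP _ htz
    have h := (hasDerivAt_id t).smul (hPd.hasFDerivAt.comp_hasDerivAt t
      ((hasDerivAt_id t).smul_const z))
    convert! h using 1
    simp only [id, one_smul, ← map_smul, Function.comp_apply, hPe]
    simp [φ]
  let q : C(I, R) := ⟨fun t => φ t, continuous_iff_continuousAt.2 fun t =>
    ContinuousAt.comp (hφ t t.2).continuousAt continuous_subtype_val.continuousAt⟩
  have hq : q = pathPrimitive R (Ω z * q) := by
    ext t
    have hsubI : Set.uIcc (0 : ℝ) t ⊆ I := by
      rw [Set.uIcc_of_le t.2.1]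
      exact Set.Icc_subset_Icc_right t.2.2
    rw [pathPrimitive_apply, intervalIntegral.integral_eq_sub_of_hasDerivAt (f := φ)]
    · simp [φ, q]
    · intro s hs
      convert! hφ s (hsubI hs) using 1
      rw [Set.IccExtend_of_mem _ _ (hsubI hs), ContinuousMap.mul_apply, hΩω z (hsub hz)]
      rfl
    · exact (ContinuousMap.continuous _).Icc_extend'.intervalIntegrable _ _
  have h := DFunLike.congr_fun ((hball z (hsub hz)).2.1.2 q hq) 1
  simpa [q, φ, P, sub_eq_zero] using h

end Frobenius

section System

/-- A flat linear analytic system `W_x = A * W`, `W_y = B * W` in a Banach algebra has, near the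
origin, an analytic fundamental solution. -/
theorem exists_fundamentalSolution {R : Type*} [NormedRing R] [NormedAlgebra ℝ R] [CompleteSpace R]
    {A B : ℝ × ℝ → R} (hA : AnalyticAt ℝ A 0) (hB : AnalyticAt ℝ B 0)
    (hflat : ∀ᶠ z in 𝓝 0, fderiv ℝ B z (1, 0) - fderiv ℝ A z (0, 1) = A z * B z - B z * A z) :
    ∃ W : ℝ × ℝ → R, AnalyticAt ℝ W 0 ∧ W 0 = 1 ∧
      ∀ᶠ z in 𝓝 0, fderiv ℝ W z (1, 0) = A z * W z ∧ fderiv ℝ W z (0, 1) = B z * W z := by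
  let Lx : R →L[ℝ] ℝ × ℝ →L[ℝ] R :=
    ContinuousLinearMap.smulRightL ℝ (ℝ × ℝ) R (ContinuousLinearMap.fst ℝ ℝ ℝ)
  let Ly : R →L[ℝ] ℝ × ℝ →L[ℝ] R :=
    ContinuousLinearMap.smulRightL ℝ (ℝ × ℝ) R (ContinuousLinearMap.snd ℝ ℝ ℝ)
  have hLx : ∀ M v, Lx M v = v.1 • M := fun _ _ => rfl
  have hLy : ∀ M v, Ly M v = v.2 • M := fun _ _ => rfl
  let ω : ℝ × ℝ → ℝ × ℝ →L[ℝ] R := fun z => Lx (A z) + Ly (B z)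
  have hω : AnalyticAt ℝ ω 0 := ((Lx.analyticAt _).comp hA).add ((Ly.analyticAt _).comp hB)
  obtain ⟨W, hW, hW0, hWω⟩ := hω.exists_fderiv_eq_mul (by
    filter_upwards [hflat, hA.eventually_analyticAt, hB.eventually_analyticAt]
      with z hz hAz hBz u v
    have hd : HasFDerivAt ω (Lx.comp (fderiv ℝ A z) + Ly.comp (fderiv ℝ B z)) z :=
      (Lx.hasFDerivAt.comp z hAz.differentiableAt.hasFDerivAt).add
        (Ly.hasFDerivAt.comp z hBz.differentiableAt.hasFDerivAt)
    have hlin : ∀ (M : ℝ × ℝ → R) (v : ℝ × ℝ),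
        fderiv ℝ M z v = v.1 • fderiv ℝ M z (1, 0) + v.2 • fderiv ℝ M z (0, 1) := by
      intro M v
      rw [← map_smul, ← map_smul, ← map_add]
      simp
    have hc := congrArg (fun M => (u.1 * v.2 - u.2 * v.1) • M) hz
    rw [hd.fderiv]
    simp only [add_apply, ContinuousLinearMap.comp_apply, hLx, hLy, ω]
    rw [hlin A u, hlin A v, hlin B u, hlin B v]
    simp only [add_mul, mul_add, smul_mul_smul_comm] at hc ⊢
    linear_combination (norm := module) hc)
  refine ⟨W, hW, hW0, ?_⟩
  filter_upwards [hWω] with z hz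
  simp [hz, ω, hLx, hLy]

attribute [local instance] Matrix.linftyOpNormedRing Matrix.linftyOpNormedAlgebra

/-- A flat linear analytic system `U_x = A * U`, `U_y = B * U` has, near the origin, an analytic
fundamental matrix. -/
theorem exists_fundamentalMatrix {n : Type*} [Fintype n] [DecidableEq n]
    {A B : n → n → ℝ × ℝ → ℝ} (hA : ∀ i j, AnalyticAt ℝ (A i j) 0)
    (hB : ∀ i j, AnalyticAt ℝ (B i j) 0)
    (hflat : ∀ᶠ z in 𝓝 0, ∀ i j, pdx (B i j) z - pdy (A i j) z
      = ∑ k, A i k z * B k j z - ∑ k, B i k z * A k j z) :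
    ∃ U : n → n → ℝ × ℝ → ℝ, (∀ i j, AnalyticAt ℝ (U i j) 0) ∧
      (∀ i j, U i j 0 = (1 : Matrix n n ℝ) i j) ∧
      ∀ᶠ z in 𝓝 0, ∀ i j, pdx (U i j) z = ∑ k, A i k z * U k j z ∧
        pdy (U i j) z = ∑ k, B i k z * U k j z := by
  have : CompleteSpace (Matrix n n ℝ) := FiniteDimensional.complete ℝ _
  let entry : n → n → Matrix n n ℝ →L[ℝ] ℝ := fun i j =>
    (Matrix.entryLinearMap ℝ ℝ i j).toContinuousLinearMap
  have key : ∀ C : n → n → ℝ × ℝ → ℝ, (∀ i j, AnalyticAt ℝ (C i j) 0) →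
      AnalyticAt ℝ (fun z => (Matrix.of fun i j => C i j z : Matrix n n ℝ)) 0 := by
    intro C hC
    have h : AnalyticAt ℝ (fun z => ∑ i, ∑ j, C i j z • (Matrix.single i j 1 : Matrix n n ℝ)) 0 :=
      Finset.analyticAt_fun_sum _ fun i _ => Finset.analyticAt_fun_sum _ fun j _ =>
        (hC i j).smul analyticAt_const
    convert! h using 2 with z
    rw [Matrix.matrix_eq_sum_single (Matrix.of fun i j => C i j z)]
    simp [Matrix.smul_single]
  have hfd : ∀ (M : ℝ × ℝ → Matrix n n ℝ) z, DifferentiableAt ℝ M z → ∀ v i j,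
      fderiv ℝ (fun y => M y i j) z v = fderiv ℝ M z v i j := by
    intro M z hM v i j
    have h : HasFDerivAt (fun y => M y i j) ((entry i j).comp (fderiv ℝ M z)) z :=
      (entry i j).hasFDerivAt.comp z hM.hasFDerivAt
    rw [h.fderiv]
    rfl
  let MA : ℝ × ℝ → Matrix n n ℝ := fun z => Matrix.of fun i j => A i j z
  let MB : ℝ × ℝ → Matrix n n ℝ := fun z => Matrix.of fun i j => B i j z
  have hMA : AnalyticAt ℝ MA 0 := key A hA
  have hMB : AnalyticAt ℝ MB 0 := key B hB
  obtain ⟨W, hW, hW0, hWAB⟩ := exists_fundamentalSolution hMA hMB (by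
    filter_upwards [hflat, hMA.eventually_analyticAt, hMB.eventually_analyticAt] with z hz hAz hBz
    ext i j
    have hx : fderiv ℝ MB z (1, 0) i j = pdx (B i j) z := (hfd MB z hBz.differentiableAt _ i j).symm
    have hy : fderiv ℝ MA z (0, 1) i j = pdy (A i j) z := (hfd MA z hAz.differentiableAt _ i j).symm
    exact (congrArg₂ (· - ·) hx hy).trans ((hz i j).trans (congrArg₂ (· - ·)
      (Matrix.mul_apply (M := MA z)).symm (Matrix.mul_apply (M := MB z)).symm)))
  refine ⟨fun i j z => W z i j, fun i j => ((entry i j).analyticAt _).comp hW,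
    fun i j => congrArg (fun M : Matrix n n ℝ => M i j) hW0, ?_⟩
  filter_upwards [hWAB, hW.eventually_analyticAt] with z hz hWz i j
  have hx := (hfd W z hWz.differentiableAt (1, 0) i j).trans
    (congrArg (fun M : Matrix n n ℝ => M i j) hz.1)
  have hy := (hfd W z hWz.differentiableAt (0, 1) i j).trans
    (congrArg (fun M : Matrix n n ℝ => M i j) hz.2)
  exact ⟨hx.trans (Matrix.mul_apply ..), hy.trans (Matrix.mul_apply ..)⟩

end System

section PartialDerivatives

variable {f g : ℝ × ℝ → ℝ} {z : ℝ × ℝ}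

@[fun_prop]
theorem AnalyticAt.pdx (hf : AnalyticAt ℝ f z) : AnalyticAt ℝ (pdx f) z :=
  hf.fderiv.bilinear_apply (ContinuousLinearMap.id ℝ _) analyticAt_const

@[fun_prop]
theorem AnalyticAt.pdy (hf : AnalyticAt ℝ f z) : AnalyticAt ℝ (pdy f) z :=
  hf.fderiv.bilinear_apply (ContinuousLinearMap.id ℝ _) analyticAt_const

theorem Filter.EventuallyEq.pdx (h : f =ᶠ[𝓝 z] g) : pdx f =ᶠ[𝓝 z] pdx g :=
  h.fderiv.fun_comp fun T => T (1, 0)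

theorem Filter.EventuallyEq.pdy (h : f =ᶠ[𝓝 z] g) : pdy f =ᶠ[𝓝 z] pdy g :=
  h.fderiv.fun_comp fun T => T (0, 1)

theorem pdx_add (hf : AnalyticAt ℝ f z) (hg : AnalyticAt ℝ g z) :
    pdx (fun u => f u + g u) z = pdx f z + pdx g z := by
  simp [pdx, fderiv_fun_add hf.differentiableAt hg.differentiableAt]

theorem pdy_add (hf : AnalyticAt ℝ f z) (hg : AnalyticAt ℝ g z) :
    pdy (fun u => f u + g u) z = pdy f z + pdy g z := by
  simp [pdy, fderiv_fun_add hf.differentiableAt hg.differentiableAt]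

theorem pdy_neg : pdy (fun u => -f u) z = -pdy f z := by simp [pdy, fderiv_fun_neg]

theorem pdx_sub (hf : AnalyticAt ℝ f z) (hg : AnalyticAt ℝ g z) :
    pdx (fun u => f u - g u) z = pdx f z - pdx g z := by
  simp [pdx, fderiv_fun_sub hf.differentiableAt hg.differentiableAt]

theorem pdy_sub (hf : AnalyticAt ℝ f z) (hg : AnalyticAt ℝ g z) :
    pdy (fun u => f u - g u) z = pdy f z - pdy g z := by
  simp [pdy, fderiv_fun_sub hf.differentiableAt hg.differentiableAt]

theorem pdx_mul (hf : AnalyticAt ℝ f z) (hg : AnalyticAt ℝ g z) :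
    pdx (fun u => f u * g u) z = pdx f z * g z + f z * pdx g z := by
  simp [pdx, fderiv_fun_mul hf.differentiableAt hg.differentiableAt]
  ring

theorem pdy_mul (hf : AnalyticAt ℝ f z) (hg : AnalyticAt ℝ g z) :
    pdy (fun u => f u * g u) z = pdy f z * g z + f z * pdy g z := by
  simp [pdy, fderiv_fun_mul hf.differentiableAt hg.differentiableAt]
  ring

@[simp]
theorem pdx_const (c : ℝ) : pdx (fun _ => c) z = 0 := by simp [pdx]

@[simp]
theorem pdy_const (c : ℝ) : pdy (fun _ => c) z = 0 := by simp [pdy]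

theorem pdx_inv (hf : AnalyticAt ℝ f z) (h0 : f z ≠ 0) :
    pdx (fun u => (f u)⁻¹) z = -pdx f z * ((f z)⁻¹ * (f z)⁻¹) := by
  have h := (hasDerivAt_inv h0).comp_hasFDerivAt z hf.differentiableAt.hasFDerivAt
  simp [pdx, show fderiv ℝ (fun u => (f u)⁻¹) z = _ from h.fderiv]
  ring

theorem pdy_inv (hf : AnalyticAt ℝ f z) (h0 : f z ≠ 0) :
    pdy (fun u => (f u)⁻¹) z = -pdy f z * ((f z)⁻¹ * (f z)⁻¹) := by
  have h := (hasDerivAt_inv h0).comp_hasFDerivAt z hf.differentiableAt.hasFDerivAt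
  simp [pdy, show fderiv ℝ (fun u => (f u)⁻¹) z = _ from h.fderiv]
  ring

theorem AnalyticAt.pdx_pdy (hf : AnalyticAt ℝ f z) :
    _root_.pdx (_root_.pdy f) z = _root_.pdy (_root_.pdx f) z := by
  have h : ∀ u v, fderiv ℝ (fun y => fderiv ℝ f y u) z v = fderiv ℝ (fderiv ℝ f) z v u :=
    fun u v => by
      rw [fderiv_clm_apply hf.fderiv.differentiableAt (differentiableAt_const u)]
      simp
  exact (h _ _).trans ((hf.contDiffAt.isSymmSndFDerivAt_of_omega _ _).trans (h _ _).symm)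

end PartialDerivatives

section Lie

variable {G H L M r s f : ℝ × ℝ → ℝ}

/-- `f` is a projective coordinate for the equation `y_xx = G + H y_x + L y_x ^ 2 + M y_x ^ 3`: its
Hessian is the one of an affine coordinate of the connection with Thomas symbols `G, H, L, M` and
projective factor `(r, s)`. -/
def IsProjectiveCoordinate (G H L M r s f : ℝ × ℝ → ℝ) : Prop :=
  ∀ᶠ z in 𝓝 (0 : ℝ × ℝ),
    pdx (pdx f) z = (1 / 3 * H z - 2 * r z) * pdx f z - G z * pdy f z ∧
    pdy (pdx f) z = (1 / 3 * L z - s z) * pdx f z - (1 / 3 * H z + r z) * pdy f z ∧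
    pdy (pdy f) z = M z * pdx f z - (1 / 3 * L z + 2 * s z) * pdy f z

/-- The integrability conditions on a single projective coordinate. -/
theorem IsProjectiveCoordinate.integrability (hG : AnalyticAt ℝ G 0) (hH : AnalyticAt ℝ H 0)
    (hL : AnalyticAt ℝ L 0) (hM : AnalyticAt ℝ M 0) (hr : AnalyticAt ℝ r 0)
    (hs : AnalyticAt ℝ s 0) (hf : AnalyticAt ℝ f 0)
    (h : IsProjectiveCoordinate G H L M r s f) :
    ∀ᶠ z in 𝓝 (0 : ℝ × ℝ),
      (1 / 3 * pdy H z - 2 * pdy r z - G z * M z - 1 / 3 * pdx L z + pdx s z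
          + (1 / 3 * H z + r z) * (1 / 3 * L z - s z)) * pdx f z
        + (1 / 3 * pdx H z + pdx r z - pdy G z + G z * (2 / 3 * L z + s z)
          - (1 / 3 * H z + r z) * (2 / 3 * H z - r z)) * pdy f z = 0 ∧
      (pdx M z + M z * (2 / 3 * H z - r z) - 1 / 3 * pdy L z + pdy s z
          - (1 / 3 * L z - s z) * (2 / 3 * L z + s z)) * pdx f z
        + (1 / 3 * pdy H z + pdy r z - G z * M z - 1 / 3 * pdx L z - 2 * pdx s z
          + (1 / 3 * H z + r z) * (1 / 3 * L z - s z)) * pdy f z = 0 := by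
  have hxx : pdx (pdx f) =ᶠ[𝓝 0] _ := h.mono fun z hz => hz.1
  have hxy : pdy (pdx f) =ᶠ[𝓝 0] _ := h.mono fun z hz => hz.2.1
  have hyy : pdy (pdy f) =ᶠ[𝓝 0] _ := h.mono fun z hz => hz.2.2
  filter_upwards [h, hxx.pdy, hxy.pdx, hxy.pdy, hyy.pdx, hG.eventually_analyticAt,
    hH.eventually_analyticAt, hL.eventually_analyticAt, hM.eventually_analyticAt,
    hr.eventually_analyticAt, hs.eventually_analyticAt, hf.eventually_analyticAt]
    with z hz h1 h2 h3 h4 hG hH hL hM hr hs hf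
  have hc1 := hf.pdx.pdx_pdy
  have hc2 := hf.pdy.pdx_pdy
  have hc3 := hf.pdx_pdy
  have hc4 := (show pdx (pdy f) =ᶠ[𝓝 z] pdy (pdx f) from
    hf.eventually_analyticAt.mono fun y hy => hy.pdx_pdy).pdy.self_of_nhds
  simp (disch := fun_prop) only [pdx_add, pdx_sub, pdx_mul, pdy_add, pdy_sub, pdy_mul, pdx_const,
    pdy_const] at h1 h2 h3 h4
  simp only [hc3, hz.1, hz.2.1, hz.2.2] at h1 h2 h3 h4
  constructor
  · linear_combination h2 - h1 - hc1
  · linear_combination h3 - h4 + hc2 + hc4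

/-- The two partial differential equations of Lie's linearizability criterion. -/
def LieConditions (G H L M : ℝ × ℝ → ℝ) (z : ℝ × ℝ) : Prop :=
  ((0 : ℝ) =
    -2 * pdy (pdy G) z + (4/3) * pdy (pdx H) z - (2/3) * pdx (pdx L) z
      + 2 * pdy (fun u => G u * L u) z - 2 * pdx G z * M z - 4 * G z * pdx M z
      + (2/3) * H z * pdx L z - (4/3) * H z * pdy H z) ∧
  ((0 : ℝ) =
    -(2/3) * pdy (pdy H) z + (4/3) * pdy (pdx L) z - 2 * pdx (pdx M) z
      + 2 * G z * pdy M z + 4 * pdy G z * M z - 2 * pdx (fun u => H u * M u) z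
      - (2/3) * pdy H z * L z + (4/3) * L z * pdx L z)

/-- Two projective coordinates with nonvanishing Jacobian force Lie's conditions. -/
theorem IsProjectiveCoordinate.lieConditions {X Y : ℝ × ℝ → ℝ} (hG : AnalyticAt ℝ G 0)
    (hH : AnalyticAt ℝ H 0) (hL : AnalyticAt ℝ L 0) (hM : AnalyticAt ℝ M 0)
    (hr : AnalyticAt ℝ r 0) (hs : AnalyticAt ℝ s 0) (hX : AnalyticAt ℝ X 0)
    (hY : AnalyticAt ℝ Y 0) (hXp : IsProjectiveCoordinate G H L M r s X)
    (hYp : IsProjectiveCoordinate G H L M r s Y)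
    (hD : ∀ᶠ z in 𝓝 0, pdx X z * pdy Y z - pdx Y z * pdy X z ≠ 0) :
    ∀ᶠ z in 𝓝 0, LieConditions G H L M z := by
  have hsolve : ∀ {a b p q p' q' : ℝ}, p * q' - p' * q ≠ 0 → a * p + b * q = 0 →
      a * p' + b * q' = 0 → a = 0 ∧ b = 0 := by
    intro a b p q p' q' hD h h'
    constructor
    · exact (mul_eq_zero.1 (show a * (p * q' - p' * q) = 0 by
        linear_combination q' * h - q * h')).resolve_right hD
    · exact (mul_eq_zero.1 (show b * (p * q' - p' * q) = 0 by
        linear_combination p * h' - p' * h)).resolve_right hD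
  have hrs : ∀ᶠ z in 𝓝 (0 : ℝ × ℝ),
      (pdx r z = pdy G z - 1 / 3 * pdx H z - G z * (2 / 3 * L z + s z)
        + (1 / 3 * H z + r z) * (2 / 3 * H z - r z) ∧
      pdy r z = 1 / 3 * pdy H z - 1 / 3 * pdx L z - G z * M z
        + (1 / 3 * H z + r z) * (1 / 3 * L z - s z)) ∧
      pdx s z = 1 / 3 * pdy H z - 1 / 3 * pdx L z - G z * M z
        + (1 / 3 * H z + r z) * (1 / 3 * L z - s z) ∧
      pdy s z = 1 / 3 * pdy L z - pdx M z - M z * (2 / 3 * H z - r z)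
        + (1 / 3 * L z - s z) * (2 / 3 * L z + s z) := by
    filter_upwards [hXp.integrability hG hH hL hM hr hs hX,
      hYp.integrability hG hH hL hM hr hs hY, hD] with z hX hY hD
    obtain ⟨h1, h2⟩ := hsolve hD hX.1 hY.1
    obtain ⟨h3, h4⟩ := hsolve hD hX.2 hY.2
    refine ⟨⟨?_, ?_⟩, ?_, ?_⟩
    · linear_combination h2
    · linear_combination -2 / 3 * h1 - 1 / 3 * h4
    · linear_combination -1 / 3 * h1 - 2 / 3 * h4
    · linear_combination h3
  have hrx : pdx r =ᶠ[𝓝 0] _ := hrs.mono fun z hz => hz.1.1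
  have hry : pdy r =ᶠ[𝓝 0] _ := hrs.mono fun z hz => hz.1.2
  have hsx : pdx s =ᶠ[𝓝 0] _ := hrs.mono fun z hz => hz.2.1
  have hsy : pdy s =ᶠ[𝓝 0] _ := hrs.mono fun z hz => hz.2.2
  filter_upwards [hrs, hrx.pdy, hry.pdx, hsx.pdy, hsy.pdx, hG.eventually_analyticAt,
    hH.eventually_analyticAt, hL.eventually_analyticAt, hM.eventually_analyticAt,
    hr.eventually_analyticAt, hs.eventually_analyticAt]
    with z hz h1 h2 h3 h4 hG hH hL hM hr hs
  simp (disch := fun_prop) only [pdx_add, pdx_sub, pdx_mul, pdy_add, pdy_sub, pdy_mul, pdx_const,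
    pdy_const, LieConditions, hH.pdx_pdy, hL.pdx_pdy] at h1 h2 h3 h4 ⊢
  simp only [hz.1.1, hz.1.2, hz.2.1, hz.2.2] at h1 h2 h3 h4
  constructor
  · linear_combination 2 * (h2 - h1 - hr.pdx_pdy)
  · linear_combination 2 * (h4 - h3 - hs.pdx_pdy)

/-- Lie's conditions provide projective coordinates with prescribed `1`-jets at the origin. -/
theorem exists_isProjectiveCoordinate (hG : AnalyticAt ℝ G 0)
    (hH : AnalyticAt ℝ H 0) (hL : AnalyticAt ℝ L 0) (hM : AnalyticAt ℝ M 0)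
    (hLie : ∀ᶠ z in 𝓝 0, LieConditions G H L M z) :
    ∃ X Y r s : ℝ × ℝ → ℝ, AnalyticAt ℝ X 0 ∧ AnalyticAt ℝ Y 0 ∧
      (pdx X 0 = 1 ∧ pdy X 0 = 0 ∧ pdx Y 0 = 0 ∧ pdy Y 0 = 1) ∧
      IsProjectiveCoordinate G H L M r s X ∧ IsProjectiveCoordinate G H L M r s Y := by
  let a : ℝ × ℝ → ℝ := fun z => pdy G z - 1 / 3 * pdx H z - 2 / 3 * G z * L z + 2 / 9 * H z * H z
  let b : ℝ × ℝ → ℝ := fun z =>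
    1 / 3 * pdy H z - 1 / 3 * pdx L z - G z * M z + 1 / 9 * H z * L z
  let c : ℝ × ℝ → ℝ := fun z => 1 / 3 * pdy L z - pdx M z + 2 / 9 * L z * L z - 2 / 3 * H z * M z
  have ha : AnalyticAt ℝ a 0 := by fun_prop
  have hb : AnalyticAt ℝ b 0 := by fun_prop
  have hc : AnalyticAt ℝ c 0 := by fun_prop
  let A : Fin 3 → Fin 3 → ℝ × ℝ → ℝ :=
    ![![fun _ => 0, fun _ => 1, fun _ => 0],
      ![a, fun z => 1 / 3 * H z, fun z => -G z],
      ![b, fun z => 1 / 3 * L z, fun z => -1 / 3 * H z]]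
  let B : Fin 3 → Fin 3 → ℝ × ℝ → ℝ :=
    ![![fun _ => 0, fun _ => 0, fun _ => 1],
      ![b, fun z => 1 / 3 * L z, fun z => -1 / 3 * H z],
      ![c, M, fun z => -1 / 3 * L z]]
  obtain ⟨U, hU, hU0, hUAB⟩ := exists_fundamentalMatrix (A := A) (B := B)
    (by
      intro i j
      fin_cases i <;> fin_cases j <;> simp [A] <;> fun_prop)
    (by
      intro i j
      fin_cases i <;> fin_cases j <;> simp [B] <;> fun_prop)
    (by
      filter_upwards [hLie, hG.eventually_analyticAt, hH.eventually_analyticAt,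
        hL.eventually_analyticAt, hM.eventually_analyticAt] with z hz hG hH hL hM
      intro i j
      obtain ⟨h1, h2⟩ := hz
      simp (disch := fun_prop) only [pdx_mul, pdy_mul] at h1 h2
      fin_cases i <;> fin_cases j <;> simp [A, B, Fin.sum_univ_three] <;>
        simp (disch := fun_prop) only [a, b, c, pdx_add, pdx_sub, pdx_mul, pdy_add, pdy_sub,
          pdy_mul, pdy_neg, pdx_const, pdy_const, hH.pdx_pdy, hL.pdx_pdy] <;>
        first
        | ring1
        | linear_combination (-1 / 2) * h1
        | linear_combination (-1 / 2) * h2)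
  have hu0 : U 0 0 0 ≠ 0 := by simp [hU0]
  let v : ℝ × ℝ → ℝ := fun z => (U 0 0 z)⁻¹
  have hv : AnalyticAt ℝ v 0 := (hU 0 0).inv hu0
  let r : ℝ × ℝ → ℝ := fun z => U 1 0 z * v z
  let s : ℝ × ℝ → ℝ := fun z => U 2 0 z * v z
  have hr : AnalyticAt ℝ r 0 := (hU 1 0).mul hv
  have hs : AnalyticAt ℝ s 0 := (hU 2 0).mul hv
  have hUne : ∀ᶠ z in 𝓝 0, U 0 0 z ≠ 0 := (hU 0 0).continuousAt.eventually_ne hu0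
  have hUan : ∀ᶠ z in 𝓝 0, ∀ i j, AnalyticAt ℝ (U i j) z :=
    Filter.eventually_all.2 fun i => Filter.eventually_all.2 fun j => (hU i j).eventually_analyticAt
  have hvd : ∀ᶠ z in 𝓝 0, pdx v z = -r z * v z ∧ pdy v z = -s z * v z := by
    filter_upwards [hUne, hUan, hUAB] with z hz hUz hAB
    rw [show pdx v z = _ from pdx_inv (hUz 0 0) hz, show pdy v z = _ from pdy_inv (hUz 0 0) hz,
      (hAB 0 0).1, (hAB 0 0).2]
    simp only [A, B, Fin.sum_univ_three, r, s, v]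
    constructor <;> simp <;> ring
  have hX : ∀ j, AnalyticAt ℝ (fun z => U 0 j z * v z) 0 := fun j => (hU 0 j).mul hv
  have hX1 : ∀ j, ∀ᶠ z in 𝓝 0,
      pdx (fun z => U 0 j z * v z) z = U 1 j z * v z - r z * (U 0 j z * v z) ∧
      pdy (fun z => U 0 j z * v z) z = U 2 j z * v z - s z * (U 0 j z * v z) := by
    intro j
    filter_upwards [hvd, hUan, hUAB, hv.eventually_analyticAt] with z hz hUz hAB hvz
    rw [pdx_mul (hUz 0 j) hvz, pdy_mul (hUz 0 j) hvz, (hAB 0 j).1, (hAB 0 j).2, hz.1, hz.2]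
    simp only [A, B, Fin.sum_univ_three]
    constructor <;> simp <;> ring
  have hproj : ∀ j, IsProjectiveCoordinate G H L M r s fun z => U 0 j z * v z := by
    intro j
    have hx : pdx (fun z => U 0 j z * v z) =ᶠ[𝓝 0] _ := (hX1 j).mono fun z hz => hz.1
    have hy : pdy (fun z => U 0 j z * v z) =ᶠ[𝓝 0] _ := (hX1 j).mono fun z hz => hz.2
    filter_upwards [hx.pdx, hx.pdy, hy.pdy, hX1 j, hvd, hUne, hUan, hUAB,
      hv.eventually_analyticAt] with z hxx hxy hyy h1 hvz hne hUz hAB hva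
    have hinv : U 0 0 z * v z = 1 := mul_inv_cancel₀ hne
    have := hUz 0 0; have := hUz 1 0; have := hUz 2 0
    have := hUz 0 j; have := hUz 1 j; have := hUz 2 j
    rw [hxx, hxy, hyy, h1.1, h1.2]
    simp (disch := fun_prop) only [pdx_sub, pdx_mul, pdy_sub, pdy_mul, r, s,
      hvz.1, hvz.2, (hAB _ _).1, (hAB _ _).2]
    simp [A, B, Fin.sum_univ_three]
    refine ⟨?_, ?_, ?_⟩
    · linear_combination (-a z * U 0 j z * v z) * hinv
    · linear_combination (-b z * U 0 j z * v z) * hinv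
    · linear_combination (-c z * U 0 j z * v z) * hinv
  refine ⟨_, _, r, s, hX 1, hX 2, ?_, hproj 1, hproj 2⟩
  rw [(hX1 1).self_of_nhds.1, (hX1 1).self_of_nhds.2, (hX1 2).self_of_nhds.1,
    (hX1 2).self_of_nhds.2]
  simp [hU0, v, r, s]

end Lie

/-- **Lie's linearizability criterion** for a scalar second-order ODE
`y_xx = F(x, y, y_x)`: equivalence of condition (1) (existence of a point
transformation to the free particle, in prolonged jet form) and condition (4)
(`F` is a specific cubic polynomial in `y_x` whose coefficients satisfy two
explicit second-order PDEs). -/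
theorem lie_linearizability_criterion (F : ℝ × ℝ × ℝ → ℝ)
    (V : Set (ℝ × ℝ × ℝ)) (hV : V ∈ nhds (0 : ℝ × ℝ × ℝ))
    (hF : AnalyticOnNhd ℝ F V) :
    (∃ X Y : ℝ × ℝ → ℝ, ∃ W ∈ nhds (0 : ℝ × ℝ),
      AnalyticOnNhd ℝ X W ∧ AnalyticOnNhd ℝ Y W ∧
      pdx X 0 = 1 ∧ pdy X 0 = 0 ∧ pdx Y 0 = 0 ∧ pdy Y 0 = 1 ∧
      ∃ V' ∈ nhds (0 : ℝ × ℝ × ℝ), ∀ w ∈ V',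
        (0 : ℝ) =
          F w * (pdx X (w.1, w.2.1) * pdy Y (w.1, w.2.1)
                  - pdx Y (w.1, w.2.1) * pdy X (w.1, w.2.1))
          + (pdx X (w.1, w.2.1) * pdx (pdx Y) (w.1, w.2.1)
              - pdx Y (w.1, w.2.1) * pdx (pdx X) (w.1, w.2.1))
          + w.2.2 * (2 * (pdx X (w.1, w.2.1) * pdy (pdx Y) (w.1, w.2.1)
                            - pdx Y (w.1, w.2.1) * pdy (pdx X) (w.1, w.2.1))
                      - (pdx (pdx X) (w.1, w.2.1) * pdy Y (w.1, w.2.1)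
                          - pdx (pdx Y) (w.1, w.2.1) * pdy X (w.1, w.2.1)))
          + w.2.2 ^ 2 * ((pdx X (w.1, w.2.1) * pdy (pdy Y) (w.1, w.2.1)
                            - pdx Y (w.1, w.2.1) * pdy (pdy X) (w.1, w.2.1))
                          - 2 * (pdy (pdx X) (w.1, w.2.1) * pdy Y (w.1, w.2.1)
                              - pdy (pdx Y) (w.1, w.2.1) * pdy X (w.1, w.2.1)))
          - w.2.2 ^ 3 * (pdy (pdy X) (w.1, w.2.1) * pdy Y (w.1, w.2.1)
              - pdy (pdy Y) (w.1, w.2.1) * pdy X (w.1, w.2.1)))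
    ↔
    (∃ G H L M : ℝ × ℝ → ℝ, ∃ W ∈ nhds (0 : ℝ × ℝ),
      AnalyticOnNhd ℝ G W ∧ AnalyticOnNhd ℝ H W ∧
      AnalyticOnNhd ℝ L W ∧ AnalyticOnNhd ℝ M W ∧
      (∃ V' ∈ nhds (0 : ℝ × ℝ × ℝ), ∀ w ∈ V',
        F w = G (w.1, w.2.1) + w.2.2 * H (w.1, w.2.1)
          + w.2.2 ^ 2 * L (w.1, w.2.1) + w.2.2 ^ 3 * M (w.1, w.2.1)) ∧
      (∀ z ∈ W,
        ((0 : ℝ) =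
          -2 * pdy (pdy G) z + (4/3) * pdy (pdx H) z - (2/3) * pdx (pdx L) z
            + 2 * pdy (fun u => G u * L u) z - 2 * pdx G z * M z - 4 * G z * pdx M z
            + (2/3) * H z * pdx L z - (4/3) * H z * pdy H z) ∧
        ((0 : ℝ) =
          -(2/3) * pdy (pdy H) z + (4/3) * pdy (pdx L) z - 2 * pdx (pdx M) z
            + 2 * G z * pdy M z + 4 * pdy G z * M z - 2 * pdx (fun u => H u * M u) z
            - (2/3) * pdy H z * L z + (4/3) * L z * pdx L z))) := by
  have hproj : Filter.Tendsto (fun w : ℝ × ℝ × ℝ => (w.1, w.2.1)) (nhds 0) (nhds 0) :=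
    Continuous.tendsto' (by fun_prop) 0 0 rfl
  constructor
  · rintro ⟨X, Y, W, hW, hXW, hYW, hXx, hXy, hYx, hYy, V', hV', hXY⟩
    have hX : AnalyticAt ℝ X 0 := hXW 0 (mem_of_mem_nhds hW)
    have hY : AnalyticAt ℝ Y 0 := hYW 0 (mem_of_mem_nhds hW)
    let D : ℝ × ℝ → ℝ := fun z => pdx X z * pdy Y z - pdx Y z * pdy X z
    have hD : AnalyticAt ℝ D 0 := by fun_prop
    have hD0 : D 0 ≠ 0 := by simp [D, hXx, hXy, hYx, hYy]
    have hDne : ∀ᶠ z in nhds 0, D z ≠ 0 := hD.continuousAt.eventually_ne hD0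
    have hE : AnalyticAt ℝ (fun z => (D z)⁻¹) 0 := hD.inv hD0
    let G : ℝ × ℝ → ℝ := fun z =>
      -(pdx X z * pdx (pdx Y) z - pdx Y z * pdx (pdx X) z) * (D z)⁻¹
    let H : ℝ × ℝ → ℝ := fun z =>
      ((pdx (pdx X) z * pdy Y z - pdx (pdx Y) z * pdy X z)
        - 2 * (pdx X z * pdy (pdx Y) z - pdx Y z * pdy (pdx X) z)) * (D z)⁻¹
    let L : ℝ × ℝ → ℝ := fun z =>
      (2 * (pdy (pdx X) z * pdy Y z - pdy (pdx Y) z * pdy X z)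
        - (pdx X z * pdy (pdy Y) z - pdx Y z * pdy (pdy X) z)) * (D z)⁻¹
    let M : ℝ × ℝ → ℝ := fun z =>
      (pdy (pdy X) z * pdy Y z - pdy (pdy Y) z * pdy X z) * (D z)⁻¹
    let r : ℝ × ℝ → ℝ := fun z =>
      -1 / 3 * ((pdx (pdx X) z * pdy Y z - pdx (pdx Y) z * pdy X z)
        + (pdx X z * pdy (pdx Y) z - pdx Y z * pdy (pdx X) z)) * (D z)⁻¹
    let s : ℝ × ℝ → ℝ := fun z =>
      -1 / 3 * ((pdy (pdx X) z * pdy Y z - pdy (pdx Y) z * pdy X z)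
        + (pdx X z * pdy (pdy Y) z - pdx Y z * pdy (pdy X) z)) * (D z)⁻¹
    have hG : AnalyticAt ℝ G 0 := by fun_prop
    have hH : AnalyticAt ℝ H 0 := by fun_prop
    have hL : AnalyticAt ℝ L 0 := by fun_prop
    have hM : AnalyticAt ℝ M 0 := by fun_prop
    have hr : AnalyticAt ℝ r 0 := by fun_prop
    have hs : AnalyticAt ℝ s 0 := by fun_prop
    have hXp : IsProjectiveCoordinate G H L M r s X := by
      filter_upwards [hDne] with z hz
      have h := mul_inv_cancel₀ hz
      simp only [G, H, L, M, r, s]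
      set e := (D z)⁻¹
      simp only [D] at h
      refine ⟨?_, ?_, ?_⟩
      · linear_combination -pdx (pdx X) z * h
      · linear_combination -pdy (pdx X) z * h
      · linear_combination -pdy (pdy X) z * h
    have hYp : IsProjectiveCoordinate G H L M r s Y := by
      filter_upwards [hDne] with z hz
      have h := mul_inv_cancel₀ hz
      simp only [G, H, L, M, r, s]
      set e := (D z)⁻¹
      simp only [D] at h
      refine ⟨?_, ?_, ?_⟩
      · linear_combination -pdx (pdx Y) z * h
      · linear_combination -pdy (pdx Y) z * h
      · linear_combination -pdy (pdy Y) z * h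
    have hLie := hXp.lieConditions hG hH hL hM hr hs hX hY hYp hDne
    refine ⟨G, H, L, M, _, (hG.eventually_analyticAt.and (hH.eventually_analyticAt.and
      (hL.eventually_analyticAt.and (hM.eventually_analyticAt.and hLie)))),
      fun z hz => hz.1, fun z hz => hz.2.1, fun z hz => hz.2.2.1, fun z hz => hz.2.2.2.1,
      ⟨_, Filter.inter_mem hV' (hproj.eventually hDne), ?_⟩, fun z hz => hz.2.2.2.2⟩
    rintro w ⟨hw, hDw⟩
    have h := mul_inv_cancel₀ (show D (w.1, w.2.1) ≠ 0 from hDw)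
    have hF := hXY w hw
    simp only [G, H, L, M]
    set e := (D (w.1, w.2.1))⁻¹
    simp only [D] at h
    linear_combination -F w * h - e * hF
  · rintro ⟨G, H, L, M, W, hW, hG, hH, hL, hM, ⟨V', hV', hFw⟩, hLie⟩
    have h0 := mem_of_mem_nhds hW
    obtain ⟨X, Y, r, s, hX, hY, ⟨hXx, hXy, hYx, hYy⟩, hXp, hYp⟩ :=
      exists_isProjectiveCoordinate (hG 0 h0) (hH 0 h0) (hL 0 h0) (hM 0 h0)
        (Filter.mem_of_superset hW hLie)
    refine ⟨X, Y, _, hX.eventually_analyticAt.and hY.eventually_analyticAt, fun z hz => hz.1,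
      fun z hz => hz.2, hXx, hXy, hYx, hYy, _,
      Filter.inter_mem hV' (hproj.eventually (hXp.and hYp)), ?_⟩
    rintro w ⟨hw, ⟨hX1, hX2, hX3⟩, hY1, hY2, hY3⟩
    rw [hFw w hw, hX1, hX2, hX3, hY1, hY2, hY3]
    ring
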